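/- Let a ∈ (0,1) and b = 1 − a. With B_x(p,q) the incomplete beta integral, B(p,q) the complete beta integral, Γ the gamma function, and H(a) = Σ_{n=0}^∞ (a/2)_n ((a+1)/2)_n² / ( ((a/2)+1)_n² n! ), the following identity holds: (2/π) · ( ∫₀^{π/2} B_{sin²φ}(a/2, b/2) dφ ) / B(a/2, b/2) = Γ((a+1)/2) / ( Γ((1−a)/2) · Γ(a/2 + 1)² ) · H(a). (This quantity is the probability that the Sticky Brownian Motion rounding does NOT separate a pair of vertices whose SDP vectors make angle θ = aπ.) -/

import Mathlib

open Real

/-- Pochhammer symbol (rising factorial): `(c)ₙ = c(c+1)⋯(c+n−1)`, with `(c)₀ = 1`. -/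
noncomputable def poch (c : ℝ) (n : ℕ) : ℝ := ∏ k ∈ Finset.range n, (c + k)

/-- Incomplete beta integral `B_x(p,q) = ∫₀ˣ t^{p−1}(1−t)^{q−1} dt`. -/
noncomputable def incBeta (p q x : ℝ) : ℝ := ∫ t in (0:ℝ)..x, t ^ (p - 1) * (1 - t) ^ (q - 1)

/-- Complete beta integral `B(p,q) = B₁(p,q)`. -/
noncomputable def betaInt (p q : ℝ) : ℝ := incBeta p q 1

/-- The hypergeometric sum
`H(a) = Σ_{n=0}^∞ (a/2)_n ((a+1)/2)_n² / ( ((a/2)+1)_n² n! )`. -/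
noncomputable def H (a : ℝ) : ℝ :=
  ∑' n : ℕ, poch (a / 2) n * (poch ((a + 1) / 2) n) ^ 2 /
    ((poch (a / 2 + 1) n) ^ 2 * (Nat.factorial n))

open MeasureTheory Filter

lemma hasSum_integral_of_nonneg_of_integrable {α : Type*} [MeasurableSpace α] {μ : Measure α}
    {g : ℕ → α → ℝ} {F : α → ℝ} (hg : ∀ n, Integrable (g n) μ) (hF : Integrable F μ)
    (hpos : ∀ᵐ x ∂μ, ∀ n, 0 ≤ g n x) (hsum : ∀ᵐ x ∂μ, HasSum (fun n => g n x) (F x)) :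
    HasSum (fun n => ∫ x, g n x ∂μ) (∫ x, F x ∂μ) := by
  have hint : ∀ n, 0 ≤ ∫ x, g n x ∂μ := fun n =>
    integral_nonneg_of_ae (hpos.mono fun x hx => hx n)
  rw [hasSum_iff_tendsto_nat_of_nonneg hint]
  simp_rw [← integral_finsetSum _ fun n _ => hg n]
  refine integral_tendsto_of_tendsto_of_monotone
    (fun n => integrable_finsetSum _ fun i _ => hg i) hF ?_ ?_
  · filter_upwards [hpos] with x hx
    exact monotone_nat_of_le_succ fun n => by
      simpa [Finset.sum_range_succ] using hx n
  · filter_upwards [hsum] with x hx using hx.tendsto_sum_nat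

lemma poch_nonneg {c : ℝ} (hc : 0 ≤ c) (n : ℕ) : 0 ≤ poch c n :=
  Finset.prod_nonneg fun _ _ => by positivity

lemma poch_pos {c : ℝ} (hc : 0 < c) (n : ℕ) : 0 < poch c n :=
  Finset.prod_pos fun _ _ => by positivity

lemma poch_eq_eval_ascPochhammer (c : ℝ) (n : ℕ) : poch c n = (ascPochhammer ℝ n).eval c := by
  induction n with
  | zero => simp [poch]
  | succ n ih =>
    rw [ascPochhammer_succ_eval, ← ih]
    simp [poch, Finset.prod_range_succ]

lemma Gamma_add_natCast_eq_poch_mul {c : ℝ} (hc : 0 < c) (n : ℕ) :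
    Gamma (c + n) = poch c n * Gamma c := by
  induction n with
  | zero => simp [poch]
  | succ n ih =>
    rw [Nat.cast_succ, ← add_assoc, Gamma_add_one (by positivity), ih]
    simp [poch, Finset.prod_range_succ]
    ring

lemma mul_poch_add_one (c : ℝ) (n : ℕ) : c * poch (c + 1) n = poch c n * (c + n) := by
  induction n with
  | zero => simp [poch]
  | succ n ih =>
    simp only [poch, Finset.prod_range_succ] at ih ⊢
    rw [← mul_assoc, ih]
    push_cast
    ring

lemma hasSum_poch_mul_pow (c : ℝ) {t : ℝ} (ht : |t| < 1) :
    HasSum (fun n : ℕ => poch c n / n.factorial * t ^ n) ((1 - t) ^ (-c)) := by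
  have h := (one_div_one_sub_rpow_hasFPowerSeriesOnBall_zero c).hasSum (y := t)
    (by simpa [enorm_eq_nnnorm, ← NNReal.coe_lt_coe] using ht)
  simp only [FormalMultilinearSeries.ofScalars_apply_eq, ← Ring.multichoose_eq, smul_eq_mul,
    zero_add] at h
  rw [rpow_neg (by linarith [(abs_lt.1 ht).2]), ← one_div]
  refine h.congr_fun fun n => ?_
  have hn := Ring.factorial_nsmul_multichoose_eq_ascPochhammer c n
  rw [Polynomial.ascPochhammer_smeval_eq_eval, ← poch_eq_eval_ascPochhammer, nsmul_eq_mul] at hn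
  rw [← hn]
  field_simp

lemma ofReal_rpow_mul_one_sub_rpow (p q : ℝ) {t : ℝ} (ht : t ∈ Set.uIcc (0 : ℝ) 1) :
    (((t ^ (p - 1) * (1 - t) ^ (q - 1) : ℝ)) : ℂ) =
      (t : ℂ) ^ ((p : ℂ) - 1) * (1 - (t : ℂ)) ^ ((q : ℂ) - 1) := by
  rw [Set.uIcc_of_le zero_le_one] at ht
  rw [Complex.ofReal_mul, Complex.ofReal_cpow ht.1, Complex.ofReal_cpow (by linarith [ht.2])]
  push_cast
  rfl

lemma intervalIntegrable_rpow_mul_one_sub_rpow {p q : ℝ} (hp : 0 < p) (hq : 0 < q) :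
    IntervalIntegrable (fun t : ℝ => t ^ (p - 1) * (1 - t) ^ (q - 1)) volume 0 1 := by
  have h := Complex.betaIntegral_convergent (u := p) (v := q) (by simpa) (by simpa)
  rw [intervalIntegrable_iff] at h ⊢
  refine IntegrableOn.congr_fun (f := fun t : ℝ => RCLike.re
    ((t : ℂ) ^ ((p : ℂ) - 1) * (1 - (t : ℂ)) ^ ((q : ℂ) - 1))) (Integrable.re h) ?_
    measurableSet_uIoc
  intro t ht
  simp only [← ofReal_rpow_mul_one_sub_rpow p q (Set.uIoc_subset_uIcc ht)]
  simp

lemma betaInt_eq_Gamma_mul_div {p q : ℝ} (hp : 0 < p) (hq : 0 < q) :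
    betaInt p q = Gamma p * Gamma q / Gamma (p + q) := by
  have h := Complex.betaIntegral_eq_Gamma_mul_div p q (by simpa) (by simpa)
  rw [Complex.betaIntegral, intervalIntegral.integral_congr
    (fun t ht => (ofReal_rpow_mul_one_sub_rpow p q ht).symm), intervalIntegral.integral_ofReal,
    ← Complex.ofReal_add] at h
  simp only [Complex.Gamma_ofReal] at h
  exact_mod_cast h

lemma hasSum_incBeta {p q x : ℝ} (hp : 0 < p) (hq : 0 < q) (hq1 : q ≤ 1) (hx0 : 0 ≤ x)
    (hx1 : x < 1) :
    HasSum (fun n : ℕ => poch (1 - q) n / n.factorial * (x ^ (p + n) / (p + n)))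
      (incBeta p q x) := by
  have hI : IntegrableOn (fun t : ℝ => t ^ (p - 1) * (1 - t) ^ (q - 1)) (Set.Ioc 0 x) := by
    have := intervalIntegrable_rpow_mul_one_sub_rpow hp hq
    rw [intervalIntegrable_iff_integrableOn_Ioc_of_le zero_le_one] at this
    exact this.mono_set (Set.Ioc_subset_Ioc_right hx1.le)
  have hJ : ∀ n : ℕ, IntervalIntegrable (fun t : ℝ => t ^ (p + n - 1)) volume 0 x := fun n =>
    intervalIntegral.intervalIntegrable_rpow' (by linarith [n.cast_nonneg (α := ℝ)])
  have key := hasSum_integral_of_nonneg_of_integrable (μ := volume.restrict (Set.Ioc 0 x))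
    (g := fun n t => poch (1 - q) n / n.factorial * t ^ (p + n - 1))
    (F := fun t : ℝ => t ^ (p - 1) * (1 - t) ^ (q - 1))
    (fun n => (((intervalIntegrable_iff_integrableOn_Ioc_of_le hx0).1 (hJ n)).const_mul _)) hI
    (ae_restrict_of_forall_mem measurableSet_Ioc fun t ht n => by
      have := poch_nonneg (sub_nonneg.2 hq1) n
      have := rpow_nonneg ht.1.le (p + n - 1)
      positivity)
    (ae_restrict_of_forall_mem measurableSet_Ioc fun t ht => by
      have h := (hasSum_poch_mul_pow (1 - q) (t := t)
        (by rw [abs_lt]; constructor <;> linarith [ht.1, ht.2])).mul_left (t ^ (p - 1))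
      rw [neg_sub] at h
      refine h.congr_fun fun n => ?_
      rw [show p + n - 1 = p - 1 + n by ring, rpow_add ht.1, rpow_natCast]
      ring)
  rw [incBeta, intervalIntegral.integral_of_le hx0]
  refine key.congr_fun fun n => ?_
  have hn : 0 < p + n := by positivity
  rw [integral_const_mul, ← intervalIntegral.integral_of_le hx0,
    integral_rpow (Or.inl (by linarith)), sub_add_cancel, zero_rpow hn.ne', sub_zero]

lemma integral_sin_sq_rpow {s : ℝ} (hs : 0 ≤ s) :
    ∫ φ in (0 : ℝ)..(π / 2), (sin φ ^ 2) ^ s =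
      √π / 2 * (Gamma (s + 1 / 2) / Gamma (s + 1)) := by
  have hpi : 0 < π / 2 := by positivity
  have hsin : ∀ φ ∈ Set.Ioo 0 (π / 2), 0 < sin φ := fun φ hφ =>
    sin_pos_of_pos_of_lt_pi hφ.1 (by linarith [hφ.2])
  have hcos : ∀ φ ∈ Set.Ioo 0 (π / 2), 0 < cos φ := fun φ hφ =>
    cos_pos_of_mem_Ioo ⟨by linarith [hφ.1], hφ.2⟩
  have himg : (fun φ => sin φ ^ 2) '' Set.Ioo 0 (π / 2) = Set.Ioo 0 1 := by
    ext x
    constructor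
    · rintro ⟨φ, hφ, rfl⟩
      exact ⟨pow_pos (hsin φ hφ) 2, by nlinarith [sin_sq_add_cos_sq φ, hcos φ hφ]⟩
    · rintro ⟨h0, h1⟩
      refine ⟨arcsin √x, ⟨arcsin_pos.2 (sqrt_pos.2 h0), arcsin_lt_pi_div_two.2 ?_⟩, ?_⟩
      · rw [sqrt_lt' one_pos]; simpa
      · simp only
        rw [sin_arcsin (by linarith [sqrt_nonneg x]) (by rw [sqrt_le_one]; exact h1.le),
          sq_sqrt h0.le]
  have hinj : Set.InjOn (fun φ => sin φ ^ 2) (Set.Ioo 0 (π / 2)) := by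
    intro u hu v hv huv
    have : sin u = sin v := (pow_left_inj₀ (hsin u hu).le (hsin v hv).le two_ne_zero).1 huv
    exact injOn_sin ⟨by linarith [hu.1], hu.2.le⟩ ⟨by linarith [hv.1], hv.2.le⟩ this
  have hsub := integral_image_eq_integral_abs_deriv_smul (f := fun φ => sin φ ^ 2)
    (f' := fun φ => 2 * sin φ * cos φ) measurableSet_Ioo
    (fun φ _ => by
      simpa using! ((hasDerivAt_sin φ).pow 2).hasDerivWithinAt) hinj
    (fun t : ℝ => t ^ (s + 1 / 2 - 1) * (1 - t) ^ ((1 / 2 : ℝ) - 1))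
  have hbeta := betaInt_eq_Gamma_mul_div (p := s + 1 / 2) (q := 1 / 2) (by positivity) (by norm_num)
  rw [betaInt, incBeta, intervalIntegral.integral_of_le zero_le_one, integral_Ioc_eq_integral_Ioo,
    ← himg, hsub, Gamma_one_half_eq, show s + 1 / 2 + 1 / 2 = s + 1 by ring,
    setIntegral_congr_fun (g := fun φ => 2 * (sin φ ^ 2) ^ s) measurableSet_Ioo ?_,
    integral_const_mul] at hbeta
  · rw [intervalIntegral.integral_of_le hpi.le, integral_Ioc_eq_integral_Ioo]
    linear_combination hbeta / 2
  · intro φ hφ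
    have h1 := hsin φ hφ
    have h2 := hcos φ hφ
    simp only [smul_eq_mul]
    rw [abs_of_pos (by positivity), ← cos_sq', show s + 1 / 2 - 1 = s + -(1 / 2) by ring,
      rpow_add (by positivity), show (1 / 2 : ℝ) - 1 = -(1 / 2) by norm_num,
      rpow_neg (by positivity), rpow_neg (by positivity), ← sqrt_eq_rpow, ← sqrt_eq_rpow,
      sqrt_sq h1.le, sqrt_sq h2.le]
    field_simp

lemma continuousOn_incBeta {p q : ℝ} (hp : 0 < p) (hq : 0 < q) :
    ContinuousOn (incBeta p q) (Set.Icc 0 1) := by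
  have := intervalIntegral.continuousOn_primitive_interval
    (intervalIntegrable_iff' (by simp) |>.1 (intervalIntegrable_rpow_mul_one_sub_rpow hp hq))
  rwa [Set.uIcc_of_le zero_le_one] at this

lemma hasSum_integral_incBeta_sin_sq {p q : ℝ} (hp : 0 < p) (hq : 0 < q) (hq1 : q ≤ 1) :
    HasSum (fun n : ℕ => poch (1 - q) n / n.factorial *
        (√π / 2 * (Gamma (p + n + 1 / 2) / Gamma (p + n + 1)) / (p + n)))
      (∫ φ in (0 : ℝ)..(π / 2), incBeta p q (sin φ ^ 2)) := by
  have hpi : 0 ≤ π / 2 := by positivity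
  have hcont : Continuous fun φ => incBeta p q (sin φ ^ 2) :=
    (continuousOn_incBeta hp hq).comp_continuous (by fun_prop)
      fun φ => ⟨sq_nonneg _, sin_sq_le_one φ⟩
  have hcont' : ∀ n : ℕ, Continuous fun φ =>
      poch (1 - q) n / n.factorial * ((sin φ ^ 2) ^ (p + n) / (p + n)) := fun n =>
    continuous_const.mul ((Continuous.rpow_const (by fun_prop)
      fun φ => Or.inr (by positivity)).div_const _)
  have key := hasSum_integral_of_nonneg_of_integrable
    (μ := volume.restrict (Set.Ioo 0 (π / 2)))
    (g := fun n φ => poch (1 - q) n / n.factorial * ((sin φ ^ 2) ^ (p + n) / (p + n)))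
    (F := fun φ => incBeta p q (sin φ ^ 2))
    (fun n => (hcont' n).integrableOn_Icc.mono_set Set.Ioo_subset_Icc_self)
    (hcont.integrableOn_Icc.mono_set Set.Ioo_subset_Icc_self)
    (Eventually.of_forall fun φ n => by
      have := poch_nonneg (sub_nonneg.2 hq1) n
      positivity)
    (ae_restrict_of_forall_mem measurableSet_Ioo fun φ hφ => by
      refine hasSum_incBeta hp hq hq1 (sq_nonneg _) ?_
      have := cos_pos_of_mem_Ioo (x := φ) ⟨by linarith [hφ.1], hφ.2⟩
      nlinarith [sin_sq_add_cos_sq φ])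
  rw [intervalIntegral.integral_of_le hpi, integral_Ioc_eq_integral_Ioo]
  refine key.congr_fun fun n => ?_
  rw [integral_const_mul, integral_div, ← integral_Ioc_eq_integral_Ioo,
    ← intervalIntegral.integral_of_le hpi, integral_sin_sq_rpow (by positivity)]

theorem stmt1 (a b : ℝ) (ha : a ∈ Set.Ioo (0 : ℝ) 1) (hb : b = 1 - a) :
    2 / π * (∫ φ in (0:ℝ)..(π / 2), incBeta (a / 2) (b / 2) (Real.sin φ ^ 2)) /
        betaInt (a / 2) (b / 2) =
      Real.Gamma ((a + 1) / 2) /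
        (Real.Gamma ((1 - a) / 2) * (Real.Gamma (a / 2 + 1)) ^ 2) * H a := by
  obtain ⟨h0, h1⟩ := ha
  subst hb
  have hp : 0 < a / 2 := by positivity
  have hq : 0 < (1 - a) / 2 := by linarith
  have hr : 0 < (a + 1) / 2 := by positivity
  have hGp := Gamma_pos_of_pos hp
  have hGq := Gamma_pos_of_pos hq
  have hGr := Gamma_pos_of_pos hr
  rw [betaInt_eq_Gamma_mul_div hp hq, show a / 2 + (1 - a) / 2 = 1 / 2 by ring, Gamma_one_half_eq,
    Gamma_add_one hp.ne', ← (hasSum_integral_incBeta_sin_sq hp hq (by linarith)).tsum_eq]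
  have hterm : ∀ n : ℕ, poch (1 - (1 - a) / 2) n / n.factorial *
      (√π / 2 * (Gamma (a / 2 + n + 1 / 2) / Gamma (a / 2 + n + 1)) / (a / 2 + n)) =
      √π / 2 * Gamma ((a + 1) / 2) / ((a / 2) ^ 2 * Gamma (a / 2)) *
        (poch (a / 2) n * (poch ((a + 1) / 2) n) ^ 2 /
          ((poch (a / 2 + 1) n) ^ 2 * (Nat.factorial n))) := by
    intro n
    have hP := poch_pos hp n
    have hP1 := poch_pos (add_pos hp one_pos) n
    have hn : 0 < a / 2 + n := by positivity
    have hmul := mul_poch_add_one (a / 2) n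
    rw [show 1 - (1 - a) / 2 = (a + 1) / 2 by ring,
      show a / 2 + n + 1 / 2 = (a + 1) / 2 + n by ring,
      show a / 2 + n + 1 = (a / 2 + 1) + n by ring, Gamma_add_natCast_eq_poch_mul hr,
      Gamma_add_natCast_eq_poch_mul (add_pos hp one_pos), Gamma_add_one hp.ne',
      show a / 2 + n = a / 2 * poch (a / 2 + 1) n / poch (a / 2) n by
        rw [hmul]; field_simp]
    field_simp
  rw [tsum_congr hterm, tsum_mul_left, ← H]
  have := sqrt_pos.2 pi_pos
  field_simp
  rw [sq_sqrt pi_pos.le]
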